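/- arXiv:1211.0910 — 2 statements merged into one kernel-verified Lean document; each statement's English description precedes it below -/
import Mathlib

section
/- Let q be a prime power, T ⊆ S ⊆ GF(q), 0 ≤ u_0 ≤ u_1 < q−1, and U_0, U_1 ⊆ GF(q)∖{0} with |U_i| = u_i. Let H_1, H_2, G_1, G_2 be graphs as in the amalgam construction, each containing no cycle of length 3 or 4 (girth at least 5), and suppose that M_{H_1} ∩ M_{H_2} = ∅, M_{H_1} ∩ M_{G_2} = ∅, M_{H_2} ∩ M_{G_1} = ∅, and Ω(G_1) ∩ Ω(G_2) = ∅. Then the amalgam B*_q(S,T,u_0,u_1) contains no cycle of length 3 or 4 (its girth is at least 5) and has 2q^2 − q(u_0+u_1) − |S| − |T| vertices. -/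
open SimpleGraph Sum

/-- The vertices kept in `B_q(S,T,u₀,u₁)`: delete `S₀ = {(0,y)₀ : y ∈ S}`,
`T₀ = {(0,b)₁ : b ∈ T}`, all blocks `P_x` with `x ∈ U₀`, and all blocks `L_m` with
`m ∈ U₁`. -/
def keepR (F : Type) [Field F] (S T U0 U1 : Finset F) : ((F × F) ⊕ (F × F)) → Prop
  | Sum.inl (x, y) => x ∉ U0 ∧ ¬ (x = 0 ∧ y ∈ S)
  | Sum.inr (m, b) => m ∉ U1 ∧ ¬ (m = 0 ∧ b ∈ T)

/-- The relation defining the amalgam: the edges of `B_q` (`(x,y)₀` adjacent to `(m,b)₁`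
iff `y = m*x + b`), together with a copy of `H₁` inside the block `P₀`, a copy of `H₂`
inside the block `L₀`, a copy of `G₁` inside each surviving block `P_x`, `x ≠ 0`, and a
copy of `G₂` inside each surviving block `L_m`, `m ≠ 0`. -/
def amalRel (F : Type) [Field F] (U0 U1 : Finset F) (H1 H2 G1 G2 : SimpleGraph F) :
    ((F × F) ⊕ (F × F)) → ((F × F) ⊕ (F × F)) → Prop
  | Sum.inl (x, y), Sum.inr (m, b) => y = m * x + b
  | Sum.inl (x, y), Sum.inl (x', y') =>
      x = x' ∧ ((x = 0 ∧ H1.Adj y y') ∨ (x ≠ 0 ∧ x ∉ U0 ∧ G1.Adj y y'))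
  | Sum.inr (m, b), Sum.inr (m', b') =>
      m = m' ∧ ((m = 0 ∧ H2.Adj b b') ∨ (m ≠ 0 ∧ m ∉ U1 ∧ G2.Adj b b'))
  | _, _ => False

/-- The amalgam graph `B*_q(S,T,u₀,u₁)` on the surviving vertices. -/
def amalgam (F : Type) [Field F] (S T U0 U1 : Finset F) (H1 H2 G1 G2 : SimpleGraph F) :
    SimpleGraph {v // keepR F S T U0 U1 v} :=
  (SimpleGraph.fromRel (amalRel F U0 U1 H1 H2 G1 G2)).induce (setOf (keepR F S T U0 U1))

/-- The set of weights (Cayley colours) `Ω(H) = {±(a−b) : ab ∈ E(H)}` of a graph on the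
elements of a field. -/
def weights {F : Type} [Field F] (H : SimpleGraph F) : Set F :=
  {w | ∃ a b, H.Adj a b ∧ w = a - b}

/-- A graph has girth at least `5` iff it has no triangle and every closed walk of length `4`
is degenerate. -/
theorem SimpleGraph.five_le_egirth_iff {V : Type*} {G : SimpleGraph V} :
    5 ≤ G.egirth ↔ (∀ a b c, G.Adj a b → G.Adj b c → ¬ G.Adj c a) ∧
      ∀ a b c d, G.Adj a b → G.Adj b c → G.Adj c d → G.Adj d a → a = c ∨ b = d := by
  rw [SimpleGraph.le_egirth]
  constructor
  · intro h
    constructor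
    · intro a b c hab hbc hca
      have hc : (Walk.cons hab (.cons hbc (.cons hca .nil))).IsCycle := by
        have := hab.ne
        have := hbc.ne
        have := hca.ne
        simp [Walk.isCycle_def, Walk.isTrail_def]
        grind
      have := h _ _ hc
      norm_num at this
    · intro a b c d hab hbc hcd hda
      by_contra! hne
      have hc : (Walk.cons hab (.cons hbc (.cons hcd (.cons hda .nil)))).IsCycle := by
        have := hab.ne
        have := hbc.ne
        have := hcd.ne
        have := hda.ne
        simp [Walk.isCycle_def, Walk.isTrail_def]
        grind
      have := h _ _ hc
      norm_num at this
  · rintro ⟨h3, h4⟩ a w hw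
    have h3l := hw.three_le_length
    by_contra hlt
    have hlen : w.length < 5 := by
      by_contra hge
      exact hlt (by exact_mod_cast not_lt.mp hge)
    match w, hw, h3l, hlen with
    | .cons hab (.cons hbc (.cons hca .nil)), _, _, _ => exact h3 _ _ _ hab hbc hca
    | .cons hab (.cons hbc (.cons hcd (.cons hda .nil))), hw, _, _ =>
      have := h4 _ _ _ _ hab hbc hcd hda
      simp [Walk.isCycle_def, Walk.isTrail_def] at hw
      grind
    | .cons _ (.cons _ (.cons _ (.cons _ (.cons _ _)))), _, _, hlen =>
      simp only [Walk.length_cons] at hlen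
      omega

/-- The graph induced on the blocks with label `x`: `H` if `x = 0` and `G` otherwise. -/
noncomputable def blockGraph {F : Type} [Field F] (H G : SimpleGraph F) (x : F) : SimpleGraph F :=
  open Classical in if x = 0 then H else G

theorem five_le_egirth_blockGraph {F : Type} [Field F] {H G : SimpleGraph F}
    (hH : 5 ≤ H.egirth) (hG : 5 ≤ G.egirth) (x : F) : 5 ≤ (blockGraph H G x).egirth := by
  unfold blockGraph
  split_ifs <;> assumption

section amalRel

variable {F : Type} [Field F] {U0 U1 : Finset F} {H1 H2 G1 G2 : SimpleGraph F}

theorem fromRel_amalRel_inl_inl {p p' : F × F}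
    (h : (fromRel (amalRel F U0 U1 H1 H2 G1 G2)).Adj (inl p) (inl p')) :
    p.1 = p'.1 ∧ (blockGraph H1 G1 p.1).Adj p.2 p'.2 := by
  obtain ⟨x, y⟩ := p
  obtain ⟨x', y'⟩ := p'
  simp only [fromRel_adj, amalRel, H1.adj_comm y' y, G1.adj_comm y' y] at h
  unfold blockGraph
  grind

theorem fromRel_amalRel_inr_inr {l l' : F × F}
    (h : (fromRel (amalRel F U0 U1 H1 H2 G1 G2)).Adj (inr l) (inr l')) :
    l.1 = l'.1 ∧ (blockGraph H2 G2 l.1).Adj l.2 l'.2 := by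
  obtain ⟨m, b⟩ := l
  obtain ⟨m', b'⟩ := l'
  simp only [fromRel_adj, amalRel, H2.adj_comm b' b, G2.adj_comm b' b] at h
  unfold blockGraph
  grind

theorem fromRel_amalRel_inl_inr {p l : F × F}
    (h : (fromRel (amalRel F U0 U1 H1 H2 G1 G2)).Adj (inl p) (inr l)) :
    p.2 = l.1 * p.1 + l.2 := by
  simpa [amalRel] using h

theorem fromRel_amalRel_inr_inl {p l : F × F}
    (h : (fromRel (amalRel F U0 U1 H1 H2 G1 G2)).Adj (inr l) (inl p)) :
    p.2 = l.1 * p.1 + l.2 :=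
  fromRel_amalRel_inl_inr h.symm

/-- No edge of a point block is joined to an edge of a line block by two incidences. -/
theorem not_blockGraph_adj_of_incident
    (hM12 : ∀ a b : F, H1.Adj a b → ¬ H2.Adj a b)
    (hM1G2 : ∀ a b : F, H1.Adj a b → ¬ G2.Adj a b)
    (hM2G1 : ∀ a b : F, H2.Adj a b → ¬ G1.Adj a b)
    (hΩ : weights G1 ∩ weights G2 = ∅) {x y y' m b b' : F}
    (h : y = m * x + b) (h' : y' = m * x + b')
    (hP : (blockGraph H1 G1 x).Adj y y') : ¬ (blockGraph H2 G2 m).Adj b b' := by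
  intro hL
  unfold blockGraph at hP hL
  split_ifs at hP hL with hx hm hm
  · simp_all
  · simp_all
  · simp_all
  · have : y - y' ∈ weights G1 ∩ weights G2 :=
      ⟨⟨y, y', hP, rfl⟩, ⟨b, b', hL, by rw [h, h']; ring⟩⟩
    simp [hΩ] at this

theorem five_le_egirth_fromRel_amalRel
    (g1 : 5 ≤ H1.egirth) (g2 : 5 ≤ H2.egirth) (g3 : 5 ≤ G1.egirth) (g4 : 5 ≤ G2.egirth)
    (hM12 : ∀ a b : F, H1.Adj a b → ¬ H2.Adj a b)
    (hM1G2 : ∀ a b : F, H1.Adj a b → ¬ G2.Adj a b)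
    (hM2G1 : ∀ a b : F, H2.Adj a b → ¬ G1.Adj a b)
    (hΩ : weights G1 ∩ weights G2 = ∅) :
    5 ≤ (fromRel (amalRel F U0 U1 H1 H2 G1 G2)).egirth := by
  have hP x := five_le_egirth_iff.1 (five_le_egirth_blockGraph g1 g3 x)
  have hL m := five_le_egirth_iff.1 (five_le_egirth_blockGraph g2 g4 m)
  have hPL {x y y' m b b' : F} := @not_blockGraph_adj_of_incident F _ H1 H2 G1 G2
    hM12 hM1G2 hM2G1 hΩ x y y' m b b'
  have hPne {x y} : ¬ (blockGraph H1 G1 x).Adj y y := SimpleGraph.irrefl _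
  have hLne {x y} : ¬ (blockGraph H2 G2 x).Adj y y := SimpleGraph.irrefl _
  have hPs {x y y'} : (blockGraph H1 G1 x).Adj y y' → (blockGraph H1 G1 x).Adj y' y :=
    fun h => h.symm
  have hLs {x y y'} : (blockGraph H2 G2 x).Adj y y' → (blockGraph H2 G2 x).Adj y' y :=
    fun h => h.symm
  have hB {x y x' y' m b m' b' : F} (h1 : y = m * x + b) (h2 : y = m' * x + b')
      (h3 : y' = m * x' + b) (h4 : y' = m' * x' + b') :
      (x = x' ∧ y = y') ∨ (m = m' ∧ b = b') := by
    have : (x - x') * (m - m') = 0 := by linear_combination -h1 + h2 + h3 - h4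
    rcases mul_eq_zero.1 this with h | h
    · obtain rfl := sub_eq_zero.1 h
      exact .inl ⟨rfl, h1.trans h3.symm⟩
    · obtain rfl := sub_eq_zero.1 h
      exact .inr ⟨rfl, add_left_cancel (h1.symm.trans h2)⟩
  rw [five_le_egirth_iff]
  constructor
  · rintro (⟨x, y⟩ | ⟨x, y⟩) (⟨x', y'⟩ | ⟨x', y'⟩) (⟨x'', y''⟩ | ⟨x'', y''⟩) h1 h2 h3 <;>
    first
    | replace h1 := fromRel_amalRel_inl_inl h1
    | replace h1 := fromRel_amalRel_inl_inr h1
    | replace h1 := fromRel_amalRel_inr_inl h1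
    | replace h1 := fromRel_amalRel_inr_inr h1
    all_goals
    first
    | replace h2 := fromRel_amalRel_inl_inl h2
    | replace h2 := fromRel_amalRel_inl_inr h2
    | replace h2 := fromRel_amalRel_inr_inl h2
    | replace h2 := fromRel_amalRel_inr_inr h2
    all_goals
    first
    | replace h3 := fromRel_amalRel_inl_inl h3
    | replace h3 := fromRel_amalRel_inl_inr h3
    | replace h3 := fromRel_amalRel_inr_inl h3
    | replace h3 := fromRel_amalRel_inr_inr h3
    all_goals grind
  · rintro (⟨x, y⟩ | ⟨x, y⟩) (⟨x', y'⟩ | ⟨x', y'⟩) (⟨x'', y''⟩ | ⟨x'', y''⟩)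
      (⟨x₃, y₃⟩ | ⟨x₃, y₃⟩) h1 h2 h3 h4 <;>
    first
    | replace h1 := fromRel_amalRel_inl_inl h1
    | replace h1 := fromRel_amalRel_inl_inr h1
    | replace h1 := fromRel_amalRel_inr_inl h1
    | replace h1 := fromRel_amalRel_inr_inr h1
    all_goals
    first
    | replace h2 := fromRel_amalRel_inl_inl h2
    | replace h2 := fromRel_amalRel_inl_inr h2
    | replace h2 := fromRel_amalRel_inr_inl h2
    | replace h2 := fromRel_amalRel_inr_inr h2
    all_goals
    first
    | replace h3 := fromRel_amalRel_inl_inl h3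
    | replace h3 := fromRel_amalRel_inl_inr h3
    | replace h3 := fromRel_amalRel_inr_inl h3
    | replace h3 := fromRel_amalRel_inr_inr h3
    all_goals
    first
    | replace h4 := fromRel_amalRel_inl_inl h4
    | replace h4 := fromRel_amalRel_inl_inr h4
    | replace h4 := fromRel_amalRel_inr_inl h4
    | replace h4 := fromRel_amalRel_inr_inr h4
    all_goals
    simp only [inl.injEq, inr.injEq, Prod.mk.injEq, reduceCtorEq, or_false, false_or] at *
    all_goals grind

end amalRel

/-- The number of pairs surviving on one side of the amalgam. -/
theorem natCard_survivors {F : Type} [Field F] [Fintype F] {U S : Finset F}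
    (hU : (0 : F) ∉ U) :
    Nat.card {p : F × F // p.1 ∉ U ∧ ¬ (p.1 = 0 ∧ p.2 ∈ S)} =
      (Fintype.card F - U.card) * Fintype.card F - S.card := by
  classical
  have hsub : ({0} : Finset F) ×ˢ S ⊆ Uᶜ ×ˢ Finset.univ := by
    rintro ⟨x, y⟩ h
    simp only [Finset.mem_product, Finset.mem_singleton] at h
    simp [h.1, hU]
  have hcard := Finset.card_sdiff_of_subset hsub
  rw [Finset.card_product, Finset.card_product, Finset.card_compl, Finset.card_singleton,
    Finset.card_univ, one_mul] at hcard
  rw [← hcard, Nat.card_eq_fintype_card]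
  exact Fintype.card_of_subtype _ (by simp; grind)

theorem natCard_keepR {F : Type} [Field F] [Fintype F] {S T U0 U1 : Finset F}
    (hU0 : (0 : F) ∉ U0) (hU1 : (0 : F) ∉ U1) :
    Nat.card {v // keepR F S T U0 U1 v} =
      ((Fintype.card F - U0.card) * Fintype.card F - S.card) +
        ((Fintype.card F - U1.card) * Fintype.card F - T.card) := by
  rw [Nat.card_congr Equiv.subtypeSum, Nat.card_sum]
  exact congrArg₂ _ (natCard_survivors hU0) (natCard_survivors hU1)

/-- if `H₁, H₂, G₁, G₂` all have girth at least `5`, the edge sets satisfy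
`M_{H₁} ∩ M_{H₂} = ∅`, `M_{H₁} ∩ M_{G₂} = ∅`, `M_{H₂} ∩ M_{G₁} = ∅` and
`Ω(G₁) ∩ Ω(G₂) = ∅`, then the amalgam `B*_q(S,T,u₀,u₁)` has girth at least `5` (no cycles
of length `3` or `4`) and `2q² − q(u₀+u₁) − |S| − |T|` vertices. -/
theorem stmt14 (q u0 u1 : ℕ) (hq : IsPrimePow q) (h01 : u0 ≤ u1) (h1q : u1 < q - 1)
    (F : Type) [Field F] [Fintype F] [DecidableEq F] (hF : Fintype.card F = q)
    (S T : Finset F) (hTS : T ⊆ S)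
    (U0 U1 : Finset F) (hU0 : (0 : F) ∉ U0) (hU1 : (0 : F) ∉ U1)
    (hc0 : U0.card = u0) (hc1 : U1.card = u1)
    (H1 H2 G1 G2 : SimpleGraph F)
    (hH1S : ∀ s ∈ S, ∀ a : F, ¬ H1.Adj s a)
    (hH2T : ∀ t ∈ T, ∀ a : F, ¬ H2.Adj t a)
    (g1 : 5 ≤ H1.egirth) (g2 : 5 ≤ H2.egirth) (g3 : 5 ≤ G1.egirth) (g4 : 5 ≤ G2.egirth)
    (hM12 : ∀ a b : F, H1.Adj a b → ¬ H2.Adj a b)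
    (hM1G2 : ∀ a b : F, H1.Adj a b → ¬ G2.Adj a b)
    (hM2G1 : ∀ a b : F, H2.Adj a b → ¬ G1.Adj a b)
    (hΩ : weights G1 ∩ weights G2 = ∅) :
    5 ≤ (amalgam F S T U0 U1 H1 H2 G1 G2).egirth ∧
    Nat.card {v // keepR F S T U0 U1 v} =
      2 * q ^ 2 - q * (u0 + u1) - S.card - T.card := by
  constructor
  · have h := five_le_egirth_iff.1 (five_le_egirth_fromRel_amalRel (U0 := U0) (U1 := U1)
      g1 g2 g3 g4 hM12 hM1G2 hM2G1 hΩ)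
    exact five_le_egirth_iff.2 ⟨fun a b c => h.1 a b c, fun a b c d hab hbc hcd hda =>
      (h.2 a b c d hab hbc hcd hda).imp Subtype.ext Subtype.ext⟩
  · rw [natCard_keepR hU0 hU1, hF, hc0, hc1]
    have hS : S.card ≤ q := hF ▸ S.card_le_univ
    have hT : T.card ≤ q := hF ▸ T.card_le_univ
    obtain ⟨k0, rfl⟩ : ∃ k, q = u0 + 1 + k := Nat.exists_eq_add_of_le (by omega)
    obtain ⟨k1, hk1⟩ : ∃ k, u0 + 1 + k0 = u1 + 1 + k := Nat.exists_eq_add_of_le (by omega)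
    generalize hq' : u0 + 1 + k0 = q at *
    have e0 : q - u0 = k0 + 1 := by omega
    have e1 : q - u1 = k1 + 1 := by omega
    have hsum : 2 * q ^ 2 = q * (u0 + u1) + ((k0 + 1) * q + (k1 + 1) * q) := by
      linear_combination q * (-hq' + hk1)
    rw [e0, e1, hsum, Nat.add_sub_cancel_left]
    have h0 : q ≤ (k0 + 1) * q := Nat.le_mul_of_pos_left _ (by omega)
    have h1 : q ≤ (k1 + 1) * q := Nat.le_mul_of_pos_left _ (by omega)
    omega
end

section
/- For every prime q with q ≡ 3 (mod 4) and q ≥ 7, setting r = q+1, the minimum number of vertices of a simple graph whose set of vertex degrees is exactly {r, 2r−5} and whose girth is 5 equals r(2r−5) + 1 = 2q^2 − q − 2; that is, there exists such a graph with r(2r−5)+1 vertices, and every graph with degree set {r, 2r−5} and girth 5 has at least r(2r−5)+1 vertices. -/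
open SimpleGraph

/-- Degree of a vertex, as the cardinality of its neighbour set. -/
noncomputable def ndeg {V : Type} (G : SimpleGraph V) (v : V) : ℕ :=
  (G.neighborSet v).ncard

/-- The degree set of a graph: the set of degrees of its vertices. -/
def degreeSet' {V : Type} (G : SimpleGraph V) : Set ℕ :=
  {d | ∃ v, ndeg G v = d}

/-- The set of orders of finite graphs with degree set exactly `D` and girth `5`. -/
def cageOrders (D : Set ℕ) : Set ℕ :=
  {n | ∃ (V : Type) (G : SimpleGraph V), Finite V ∧ Nat.card V = n ∧
        G.egirth = 5 ∧ degreeSet' G = D}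

theorem not_triangle_of_egirth {V : Type} {G : SimpleGraph V} (hG : 5 ≤ G.egirth) {a b c : V}
    (hab : G.Adj a b) (hbc : G.Adj b c) (hca : G.Adj c a) : False := by
  have h := G.le_egirth.mp hG a (.cons hab (.cons hbc (.cons hca .nil))) (by
    simp [Walk.isCycle_def, Walk.isTrail_def, hab.ne, hab.ne', hbc.ne, hca.ne, hca.ne'])
  norm_num [Walk.length_cons] at h

theorem common_unique_of_egirth {V : Type} {G : SimpleGraph V} (hG : 5 ≤ G.egirth) {a b c d : V}
    (hac : a ≠ c) (hab : G.Adj a b) (hbc : G.Adj b c) (had : G.Adj a d) (hdc : G.Adj d c) :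
    b = d := by
  by_contra hbd
  have h := G.le_egirth.mp hG a (.cons hab (.cons hbc (.cons hdc.symm (.cons had.symm .nil)))) (by
    simp [Walk.isCycle_def, Walk.isTrail_def, hab.ne, hab.ne', hbc.ne, had.ne', hdc.ne', hac,
      hac.symm, hbd])
  norm_num [Walk.length_cons] at h

theorem five_le_egirth {V : Type} {G : SimpleGraph V}
    (h₃ : ∀ a b c, G.Adj a b → G.Adj b c → G.Adj c a → False)
    (h₄ : ∀ a b c d, a ≠ c → G.Adj a b → G.Adj b c → G.Adj a d → G.Adj d c → b = d) :
    5 ≤ G.egirth := by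
  rw [G.le_egirth]
  intro a w hw
  have hlen := hw.three_le_length
  by_contra! hlt
  have hlt : w.length < 5 := by exact_mod_cast hlt
  match w, hw, hlen, hlt with
  | .cons hab (.cons hbc (.cons hca .nil)), _, _, _ => exact h₃ _ _ _ hab hbc hca
  | .cons hab (.cons hbc (.cons hcd (.cons hda .nil))), hw, _, _ =>
    have hnd := hw.support_nodup
    simp at hnd
    exact hnd.1.2.1 (h₄ _ _ _ _ (by tauto) hab hbc hda.symm hcd.symm)

theorem egirth_eq_five {V : Type} {G : SimpleGraph V} (hG : 5 ≤ G.egirth) {a b c d e : V}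
    (hnd : [a, b, c, d, e].Nodup)
    (hab : G.Adj a b) (hbc : G.Adj b c) (hcd : G.Adj c d) (hde : G.Adj d e) (hea : G.Adj e a) :
    G.egirth = 5 := by
  refine le_antisymm ?_ hG
  refine (G.egirth_le_length
    (w := .cons hab (.cons hbc (.cons hcd (.cons hde (.cons hea .nil))))) ?_).trans
    (by norm_num [Walk.length_cons])
  simp only [List.nodup_cons, List.mem_cons, List.not_mem_nil, or_false, not_or] at hnd
  obtain ⟨⟨n₁, n₂, n₃, n₄⟩, ⟨n₅, n₆, n₇⟩, ⟨n₈, n₉⟩, n₀, -⟩ := hnd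
  simp [Walk.isCycle_def, Walk.isTrail_def, *, Ne.symm, eq_comm]

/-- The Moore-type bound: count a vertex of degree `m` together with the neighbourhoods of its
neighbours. -/
theorem moore_bound {V : Type} [Finite V] {G : SimpleGraph V} (hG : 5 ≤ G.egirth) {r : ℕ}
    (hr : ∀ v, r ≤ ndeg G v) (v : V) : r * ndeg G v + 1 ≤ Nat.card V := by
  classical
  have := Fintype.ofFinite V
  have hdeg : ∀ w, ndeg G w = G.degree w := fun w => by
    rw [ndeg, Set.ncard_eq_toFinset_card', ← G.card_neighborFinset_eq_degree]; rfl
  let B : V → Finset V := fun w => insert w ((G.neighborFinset w).erase v)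
  have hB : ∀ w ∈ G.neighborFinset v, r ≤ (B w).card := by
    intro w hw
    rw [mem_neighborFinset] at hw
    rw [Finset.card_insert_of_notMem (by simp),
      Finset.card_erase_add_one (by simpa using hw.symm), card_neighborFinset_eq_degree, ← hdeg]
    exact hr w
  have hdisj : ((G.neighborFinset v : Finset V) : Set V).PairwiseDisjoint B := by
    intro w hw w' hw' hne
    simp only [Finset.mem_coe, mem_neighborFinset] at hw hw'
    refine Finset.disjoint_left.mpr fun z hz hz' => ?_
    simp only [B, Finset.mem_insert, Finset.mem_erase, mem_neighborFinset] at hz hz'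
    rcases hz with rfl | ⟨hzv, hz⟩ <;> rcases hz' with rfl | ⟨-, hz'⟩
    · exact hne rfl
    · exact not_triangle_of_egirth hG hw hz'.symm hw'.symm
    · exact not_triangle_of_egirth hG hw hz hw'.symm
    · exact hne (common_unique_of_egirth hG hzv.symm hw hz hw' hz')
  have hv : v ∉ (G.neighborFinset v).biUnion B := by
    simp only [B, Finset.mem_biUnion, mem_neighborFinset, Finset.mem_insert, Finset.mem_erase]
    rintro ⟨w, hw, rfl | h⟩
    · exact hw.ne rfl
    · exact h.1 rfl
  calc r * ndeg G v + 1 = ∑ w ∈ G.neighborFinset v, r + 1 := by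
        rw [Finset.sum_const, card_neighborFinset_eq_degree, hdeg, smul_eq_mul, mul_comm]
    _ ≤ ∑ w ∈ G.neighborFinset v, (B w).card + 1 := by gcongr with w hw; exact hB w hw
    _ = (insert v ((G.neighborFinset v).biUnion B)).card := by
        rw [Finset.card_insert_of_notMem hv, Finset.card_biUnion hdisj]
    _ ≤ Nat.card V := by rw [Nat.card_eq_fintype_card]; exact Finset.card_le_univ _


section Field
variable {K : Type} [Field K]

/-- Adjacency among the points of a vertical line: a star centred at `0` whose leaves are all
nonzero elements except `1` and `-1`, with the edges from `1` to `-2` and from `-1` to `2`. -/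
def starAdj (y y' : K) : Prop :=
  (y = 0 ∧ y' ≠ 0 ∧ y' ≠ 1 ∧ y' ≠ -1) ∨ (y' = 0 ∧ y ≠ 0 ∧ y ≠ 1 ∧ y ≠ -1) ∨
    (y = 1 ∧ y' = -2) ∨ (y = -2 ∧ y' = 1) ∨ (y = -1 ∧ y' = 2) ∨ (y = 2 ∧ y' = -1)

/-- Directed steps between the intercepts of parallel lines of slope `m`: translation by `1`,
and for `m = 0` the two jumps over the deleted intercepts. -/
def IsStep (m b b' : K) : Prop :=
  b' = b + 1 ∨ (m = 0 ∧ ((b = 1 ∧ b' = 3) ∨ (b = -3 ∧ b' = -1)))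

/-- The lines `(slope, intercept)` that are kept: all but `(0, 2)` and `(0, -2)`. -/
def IsRetained (l : K × K) : Prop := ¬ (l.1 = 0 ∧ (l.2 = 2 ∨ l.2 = -2))

theorem IsStep.right_unique {m b c d : K} (hc : IsRetained (m, c)) (hd : IsRetained (m, d))
    (h : IsStep m b c) (h' : IsStep m b d) : c = d := by
  unfold IsStep IsRetained at *; grind

theorem IsStep.left_unique {m b c d : K} (hc : IsRetained (m, c)) (hd : IsRetained (m, d))
    (h : IsStep m c b) (h' : IsStep m d b) : c = d := by
  unfold IsStep IsRetained at *; grind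

/-- The integers from `2` to `6` are nonzero in `K`. -/
def SmallNe (K : Type) [Field K] : Prop :=
  (2 : K) ≠ 0 ∧ (3 : K) ≠ 0 ∧ (4 : K) ≠ 0 ∧ (5 : K) ≠ 0 ∧ (6 : K) ≠ 0

theorem IsStep.not_triangle (hK : SmallNe K) {m b c d : K}
    (h : IsStep m b c) (h' : IsStep m c d) (h'' : IsStep m d b) : False := by
  obtain ⟨h2, h3, h4, h5, h6⟩ := hK
  unfold IsStep at *
  rcases h with h | ⟨-, h | h⟩ <;> rcases h' with h' | ⟨-, h' | h'⟩ <;>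
    rcases h'' with h'' | ⟨-, h'' | h''⟩ <;> grind

theorem IsStep.not_square (hK : SmallNe K) {m b c d e : K}
    (hbd : b ≠ d) (hce : c ≠ e)
    (h : IsStep m b c) (h' : IsStep m c d) (h'' : IsStep m d e) (h3 : IsStep m e b) : False := by
  obtain ⟨h2, h3, h4, h5, h6⟩ := hK
  unfold IsStep at *
  rcases h with h | ⟨-, h | h⟩ <;> rcases h' with h' | ⟨-, h' | h'⟩ <;>
    rcases h'' with h'' | ⟨-, h'' | h''⟩ <;> grind

theorem starAdj.not_triangle (hK : SmallNe K) {b c d : K}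
    (h : starAdj b c) (h' : starAdj c d) (h'' : starAdj d b) : False := by
  obtain ⟨h2, h3, h4, h5, h6⟩ := hK
  unfold starAdj at *
  rcases h with h | h | h | h | h | h <;> grind

theorem starAdj.not_square (hK : SmallNe K) {b c d e : K}
    (hbd : b ≠ d) (hce : c ≠ e)
    (h : starAdj b c) (h' : starAdj d c) (h'' : starAdj b e) (h3 : starAdj d e) : False := by
  obtain ⟨h2, h3, h4, h5, h6⟩ := hK
  unfold starAdj at *
  rcases h with h | h | h | h | h | h <;> rcases h' with h' | h' | h' | h' | h' | h' <;> grind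

theorem starAdj.not_isStep (hK : SmallNe K) {x m b c : K}
    (hb : IsRetained (m, b)) (hc : IsRetained (m, c))
    (h : starAdj (m * x + b) (m * x + c)) : ¬ IsStep m b c := by
  obtain ⟨h2, h3, h4, h5, h6⟩ := hK
  rintro (h | ⟨rfl, h⟩)
  · subst h
    unfold starAdj IsRetained at *
    grind
  · unfold starAdj IsRetained at *
    grind

theorem starAdj.symm {y y' : K} (h : starAdj y y') : starAdj y' y := by
  unfold starAdj at *; tauto

theorem starAdj.ne (hK : SmallNe K) {y y' : K} (h : starAdj y y') : y ≠ y' := by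
  obtain ⟨h2, h3, -⟩ := hK
  unfold starAdj at h
  grind

theorem IsStep.ne (hK : SmallNe K) {m b b' : K} (h : IsStep m b b') : b ≠ b' := by
  obtain ⟨h2, -⟩ := hK
  unfold IsStep at h
  grind

/-- Adjacency between the intercepts of parallel lines of slope `m`. -/
def lineAdj (m b b' : K) : Prop := IsStep m b b' ∨ IsStep m b' b

theorem lineAdj.ne (hK : SmallNe K) {m b b' : K} (h : lineAdj m b b') : b ≠ b' :=
  h.elim (fun h => h.ne hK) (fun h => (h.ne hK).symm)

theorem lineAdj.not_triangle (hK : SmallNe K) {m b c d : K} (hb : IsRetained (m, b))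
    (hc : IsRetained (m, c)) (hd : IsRetained (m, d))
    (h₁ : lineAdj m b c) (h₂ : lineAdj m c d) (h₃ : lineAdj m d b) : False := by
  have n₁ := h₁.ne hK
  have n₂ := h₂.ne hK
  have n₃ := h₃.ne hK
  rcases h₁ with h₁ | h₁ <;> rcases h₂ with h₂ | h₂ <;> rcases h₃ with h₃ | h₃
  · exact h₁.not_triangle hK h₂ h₃
  · exact n₂ (h₁.right_unique hc hd h₃)
  · exact n₃ (h₁.left_unique hb hd h₂).symm
  · exact n₂ (h₁.right_unique hc hd h₃)
  · exact n₂ (h₁.left_unique hc hd h₃)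
  · exact n₃ (h₁.right_unique hb hd h₂).symm
  · exact n₂ (h₁.left_unique hc hd h₃)
  · exact h₁.not_triangle hK h₃ h₂

theorem lineAdj.not_square (hK : SmallNe K) {m b c d e : K} (hb : IsRetained (m, b))
    (hc : IsRetained (m, c)) (hd : IsRetained (m, d)) (he : IsRetained (m, e))
    (hbd : b ≠ d) (hce : c ≠ e)
    (h₁ : lineAdj m b c) (h₂ : lineAdj m c d) (h₃ : lineAdj m b e) (h₄ : lineAdj m e d) :
    False := by
  rcases h₁ with h₁ | h₁
  · rcases h₂ with h₂ | h₂
    · rcases h₃ with h₃ | h₃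
      · exact hce (h₁.right_unique hc he h₃)
      · rcases h₄ with h₄ | h₄
        · exact hce (h₂.left_unique hc he h₄)
        · exact h₁.not_square hK hbd hce h₂ h₄ h₃
    · exact hbd (h₁.left_unique hb hd h₂)
  · rcases h₂ with h₂ | h₂
    · exact hbd (h₁.right_unique hb hd h₂)
    · rcases h₃ with h₃ | h₃
      · rcases h₄ with h₄ | h₄
        · exact h₂.not_square hK hbd.symm hce h₁ h₃ h₄
        · exact hbd (h₃.left_unique hb hd h₄)
      · exact hce (h₁.left_unique hc he h₃)

theorem starAdj.not_lineAdj (hK : SmallNe K) {x m b c : K}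
    (hb : IsRetained (m, b)) (hc : IsRetained (m, c))
    (h : starAdj (m * x + b) (m * x + c)) : ¬ lineAdj m b c :=
  not_or.mpr ⟨h.not_isStep hK hb hc, h.symm.not_isStep hK hc hb⟩

variable (K) in
/-- The points off the axis `x = 0` and the retained lines. -/
abbrev CageVertex : Type := {p : K × K // p.1 ≠ 0} ⊕ {l : K × K // IsRetained l}

/-- Incidence of points with lines, together with `starAdj` on each vertical line and `lineAdj`
on each parallel class. -/
def cageAdj : CageVertex K → CageVertex K → Prop
  | .inl p, .inl p' => p.1.1 = p'.1.1 ∧ starAdj p.1.2 p'.1.2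
  | .inl p, .inr l => p.1.2 = l.1.1 * p.1.1 + l.1.2
  | .inr l, .inl p => p.1.2 = l.1.1 * p.1.1 + l.1.2
  | .inr l, .inr l' => l.1.1 = l'.1.1 ∧ lineAdj l.1.1 l.1.2 l'.1.2

/-- The graph on points off the axis `x = 0` and retained lines with adjacency `cageAdj`. -/
def cageGraph (hK : SmallNe K) : SimpleGraph (CageVertex K) where
  Adj := cageAdj
  symm := ⟨by
    rintro (p | l) (p' | l') h
    · exact ⟨h.1.symm, h.2.symm⟩
    · exact h
    · exact h
    · exact ⟨h.1.symm, h.1 ▸ h.2.symm⟩⟩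
  loopless := ⟨by
    rintro (p | l) h
    · exact h.2.ne hK rfl
    · exact h.2.ne hK rfl⟩

theorem cageGraph_not_triangle (hK : SmallNe K) {a b c : CageVertex K}
    (hab : (cageGraph hK).Adj a b) (hbc : (cageGraph hK).Adj b c)
    (hca : (cageGraph hK).Adj c a) : False := by
  have hps : ∀ (p p' : {p : K × K // p.1 ≠ 0}) (l : {l : K × K // IsRetained l}),
      cageAdj (.inl p) (.inl p') → cageAdj (.inl p) (.inr l) → cageAdj (.inl p') (.inr l) →
        False := by
    rintro ⟨⟨x, y⟩, hx⟩ ⟨⟨x', y'⟩, hx'⟩ ⟨⟨m, k⟩, hl⟩ h h₁ h₂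
    simp only [cageAdj] at h h₁ h₂
    obtain ⟨rfl, h⟩ := h
    exact h.ne hK (h₁.trans h₂.symm)
  have hls : ∀ (l l' : {l : K × K // IsRetained l}) (p : {p : K × K // p.1 ≠ 0}),
      cageAdj (.inr l) (.inr l') → cageAdj (.inl p) (.inr l) → cageAdj (.inl p) (.inr l') →
        False := by
    rintro ⟨⟨m, k⟩, hl⟩ ⟨⟨m', k'⟩, hl'⟩ ⟨⟨x, y⟩, hx⟩ h h₁ h₂
    simp only [cageAdj] at h h₁ h₂
    obtain ⟨rfl, h⟩ := h
    exact h.ne hK (add_left_cancel (h₁.symm.trans h₂))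
  rcases a with a | a <;> rcases b with b | b <;> rcases c with c | c
  · obtain ⟨-, hab⟩ := hab
    exact hab.not_triangle hK hbc.2 hca.2
  · exact hps a b c hab hca hbc
  · exact hps c a b hca hbc hab
  · exact hls b c a hbc hab hca
  · exact hps b c a hbc hab hca
  · exact hls c a b hca hbc hab
  · exact hls a b c hab hca hbc
  · obtain ⟨⟨m, k⟩, ha⟩ := a
    obtain ⟨⟨m', k'⟩, hb⟩ := b
    obtain ⟨⟨m'', k''⟩, hc⟩ := c
    obtain ⟨h₁, hab⟩ := hab
    obtain ⟨h₂, hbc⟩ := hbc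
    obtain ⟨-, hca⟩ := hca
    dsimp only at *
    subst h₁ h₂
    exact hab.not_triangle hK ha hb hc hbc hca

theorem cageGraph_common_unique (hK : SmallNe K) {a b c d : CageVertex K} (hac : a ≠ c)
    (hab : (cageGraph hK).Adj a b) (hbc : (cageGraph hK).Adj b c)
    (had : (cageGraph hK).Adj a d) (hdc : (cageGraph hK).Adj d c) : b = d := by
  by_contra hbd
  change cageAdj a b at hab
  change cageAdj b c at hbc
  change cageAdj a d at had
  change cageAdj d c at hdc
  rcases a with ⟨⟨a₁, a₂⟩, ha⟩ | ⟨⟨a₁, a₂⟩, ha⟩ <;>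
  rcases c with ⟨⟨c₁, c₂⟩, hc⟩ | ⟨⟨c₁, c₂⟩, hc⟩ <;>
  rcases b with ⟨⟨b₁, b₂⟩, hb⟩ | ⟨⟨b₁, b₂⟩, hb⟩ <;>
  rcases d with ⟨⟨d₁, d₂⟩, hd⟩ | ⟨⟨d₁, d₂⟩, hd⟩ <;>
  simp only [cageAdj, ne_eq, reduceCtorEq, not_false_eq_true,
    Sum.inl.injEq, Sum.inr.injEq, Subtype.mk.injEq, Prod.mk.injEq] at *
  · obtain ⟨rfl, h₁⟩ := hab
    obtain ⟨rfl, h₂⟩ := hbc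
    obtain ⟨rfl, h₃⟩ := had
    obtain ⟨-, h₄⟩ := hdc
    exact h₁.not_square hK (by simpa using hac) (by simpa using hbd) h₂.symm h₃ h₄.symm
  · grind
  · grind
  · grind
  · grind
  · obtain ⟨rfl, h₁⟩ := hab
    obtain ⟨rfl, h₂⟩ := hdc
    subst hbc had
    exact h₁.not_lineAdj hK hd hc h₂
  · obtain ⟨rfl, h₁⟩ := had
    obtain ⟨rfl, h₂⟩ := hbc
    subst hab hdc
    exact h₁.not_lineAdj hK hb hc h₂
  · grind
  · grind
  · obtain ⟨rfl, h₁⟩ := had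
    obtain ⟨rfl, h₂⟩ := hbc
    subst hab hdc
    exact h₂.not_lineAdj hK ha hd h₁
  · obtain ⟨rfl, h₁⟩ := hab
    obtain ⟨rfl, h₂⟩ := hdc
    subst hbc had
    exact h₂.not_lineAdj hK ha hb h₁
  · grind
  · grind
  · grind
  · grind
  · obtain ⟨rfl, h₁⟩ := hab
    obtain ⟨rfl, h₂⟩ := hbc
    obtain ⟨rfl, h₃⟩ := had
    obtain ⟨-, h₄⟩ := hdc
    exact h₁.not_square hK ha hb hc hd (by simpa using hac) (by simpa using hbd) h₂ h₃ h₄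

theorem ncard_eq_add_preimage {α β : Type} [Finite α] [Finite β] (S : Set (α ⊕ β)) :
    S.ncard = (Sum.inl ⁻¹' S).ncard + (Sum.inr ⁻¹' S).ncard := by
  conv_lhs => rw [← Set.image_preimage_inl_union_image_preimage_inr S]
  rw [Set.ncard_union_eq, Set.ncard_image_of_injective _ Sum.inl_injective,
    Set.ncard_image_of_injective _ Sum.inr_injective]
  rw [Set.disjoint_left]
  rintro _ ⟨a, -, rfl⟩ ⟨b, -, h⟩
  exact Sum.inr_ne_inl h

theorem ndeg_point [Finite K] (hK : SmallNe K) {x y : K} (hx : x ≠ 0) :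
    ndeg (cageGraph hK) (.inl ⟨(x, y), hx⟩) =
      {y' | starAdj y y'}.ncard + {m | IsRetained (m, y - m * x)}.ncard := by
  rw [ndeg, ncard_eq_add_preimage]
  congr 1
  · rw [← Set.InjOn.ncard_image (f := fun p : {p : K × K // p.1 ≠ 0} => p.1.2)]
    · congr 1
      ext y'
      constructor
      · rintro ⟨p, ⟨-, hp⟩, rfl⟩
        exact hp
      · intro h
        exact ⟨⟨(x, y'), hx⟩, ⟨rfl, h⟩, rfl⟩
    · rintro p ⟨hp, -⟩ p' ⟨hp', -⟩ h
      exact Subtype.ext (Prod.ext (hp.symm.trans hp') h)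
  · rw [← Set.InjOn.ncard_image (f := fun l : {l : K × K // IsRetained l} => l.1.1)]
    · congr 1
      ext m
      constructor
      · rintro ⟨⟨⟨m, b⟩, hl⟩, h, rfl⟩
        change y = m * x + b at h
        simpa [h] using hl
      · intro h
        exact ⟨⟨(m, y - m * x), h⟩, show y = m * x + (y - m * x) by ring, rfl⟩
    · rintro ⟨⟨m, b⟩, hl⟩ h ⟨⟨m', b'⟩, hl'⟩ h' e
      change y = m * x + b at h
      change y = m' * x + b' at h'
      change m = m' at e
      subst e
      obtain rfl : b = b' := add_left_cancel (h.symm.trans h')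
      rfl

theorem ndeg_line [Finite K] (hK : SmallNe K) {m b : K} (hl : IsRetained (m, b)) :
    ndeg (cageGraph hK) (.inr ⟨(m, b), hl⟩) =
      ({0}ᶜ : Set K).ncard + {b' | lineAdj m b b' ∧ IsRetained (m, b')}.ncard := by
  rw [ndeg, ncard_eq_add_preimage]
  congr 1
  · rw [← Set.InjOn.ncard_image (f := fun p : {p : K × K // p.1 ≠ 0} => p.1.1)]
    · congr 1
      ext x
      constructor
      · rintro ⟨p, -, rfl⟩
        exact p.2
      · intro h
        exact ⟨⟨(x, m * x + b), h⟩, rfl, rfl⟩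
    · rintro p hp p' hp' h
      refine Subtype.ext (Prod.ext h ?_)
      change p.1.2 = m * p.1.1 + b at hp
      change p'.1.2 = m * p'.1.1 + b at hp'
      rw [hp, hp', show p.1.1 = p'.1.1 from h]
  · rw [← Set.InjOn.ncard_image (f := fun l : {l : K × K // IsRetained l} => l.1.2)]
    · congr 1
      ext b'
      constructor
      · rintro ⟨⟨⟨m', b'⟩, hl'⟩, ⟨h₁, h₂⟩, rfl⟩
        obtain rfl : m = m' := h₁
        exact ⟨h₂, hl'⟩
      · rintro ⟨h, h'⟩
        exact ⟨⟨(m, b'), h'⟩, ⟨rfl, h⟩, rfl⟩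
    · rintro p ⟨hp, -⟩ p' ⟨hp', -⟩ h
      exact Subtype.ext (Prod.ext (hp.symm.trans hp') h)

theorem ncard_lineAdj (hK : SmallNe K) {m b : K} (hl : IsRetained (m, b)) :
    {b' | lineAdj m b b' ∧ IsRetained (m, b')}.ncard = 2 := by
  obtain ⟨h2, h3, h4, h5, h6⟩ := hK
  rw [Set.ncard_eq_two]
  unfold lineAdj IsStep IsRetained at *
  simp only [Set.ext_iff, Set.mem_ofPred_eq, Set.mem_insert_iff, Set.mem_singleton_iff] at *
  by_cases hm : m = 0
  · subst hm
    by_cases b1 : b = 1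
    · exact ⟨0, 3, by grind, by grind⟩
    by_cases b2 : b = -1
    · exact ⟨0, -3, by grind, by grind⟩
    by_cases b3 : b = 3
    · exact ⟨1, 4, by grind, by grind⟩
    by_cases b4 : b = -3
    · exact ⟨-1, -4, by grind, by grind⟩
    · exact ⟨b + 1, b - 1, by grind, by grind⟩
  · exact ⟨b + 1, b - 1, by grind, by grind⟩

theorem ncard_starAdj_zero [Finite K] (hK : SmallNe K) :
    {y' | starAdj (0 : K) y'}.ncard = Nat.card K - 3 := by
  obtain ⟨h2, h3, h4, h5, h6⟩ := hK
  have h : {y' | starAdj (0 : K) y'} = {0, 1, -1}ᶜ := by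
    ext y
    simp only [starAdj, Set.mem_ofPred_eq, Set.mem_compl_iff, Set.mem_insert_iff,
      Set.mem_singleton_iff]
    grind
  rw [h, Set.ncard_compl, Set.ncard_eq_three.mpr ⟨0, 1, -1, by grind, by grind, by grind, rfl⟩]

theorem ncard_starAdj_two (hK : SmallNe K) {y : K} (hy : y = 2 ∨ y = -2) :
    {y' | starAdj y y'}.ncard = 2 := by
  obtain ⟨h2, h3, h4, h5, h6⟩ := hK
  rw [Set.ncard_eq_two]
  unfold starAdj
  simp only [Set.ext_iff, Set.mem_ofPred_eq, Set.mem_insert_iff, Set.mem_singleton_iff]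
  rcases hy with rfl | rfl
  · exact ⟨0, -1, by grind, by grind⟩
  · exact ⟨0, 1, by grind, by grind⟩

theorem ncard_starAdj_of_ne (hK : SmallNe K) {y : K} (h0 : y ≠ 0) (hy : ¬(y = 2 ∨ y = -2)) :
    {y' | starAdj y y'}.ncard = 1 := by
  obtain ⟨h2, h3, h4, h5, h6⟩ := hK
  rw [Set.ncard_eq_one]
  unfold starAdj
  simp only [Set.ext_iff, Set.mem_ofPred_eq, Set.mem_singleton_iff]
  by_cases b1 : y = 1
  · exact ⟨-2, by grind⟩
  by_cases b2 : y = -1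
  · exact ⟨2, by grind⟩
  · exact ⟨0, by grind⟩

theorem ncard_compl_zero [Finite K] : ({0}ᶜ : Set K).ncard = Nat.card K - 1 := by
  rw [Set.ncard_compl, Set.ncard_singleton]

theorem ncard_isRetained_of_two [Finite K] {x y : K} (hy : y = 2 ∨ y = -2) :
    {m | IsRetained (m, y - m * x)}.ncard = Nat.card K - 1 := by
  rw [← ncard_compl_zero]
  congr 1
  ext m
  simp only [IsRetained, Set.mem_ofPred_eq, Set.mem_compl_iff, Set.mem_singleton_iff]
  grind

theorem ncard_isRetained_of_ne {x y : K} (hy : ¬(y = 2 ∨ y = -2)) :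
    {m | IsRetained (m, y - m * x)}.ncard = Nat.card K := by
  rw [← Set.ncard_univ]
  congr 1
  ext m
  simp only [IsRetained, Set.mem_ofPred_eq, Set.mem_univ, iff_true]
  grind

theorem card_cageVertex [Finite K] (hK : SmallNe K) :
    Nat.card (CageVertex K) = (Nat.card K - 1) * Nat.card K + (Nat.card K ^ 2 - 2) := by
  obtain ⟨h2, h3, h4, h5, h6⟩ := hK
  have h₁ : {p : K × K | p.1 ≠ 0} = {0}ᶜ ×ˢ Set.univ := by ext; simp
  have h₂ : {l : K × K | IsRetained l} = {(0, 2), (0, -2)}ᶜ := by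
    ext ⟨m, b⟩
    simp only [IsRetained, Set.mem_ofPred_eq, Set.mem_compl_iff, Set.mem_insert_iff,
      Set.mem_singleton_iff, Prod.mk.injEq]
    tauto
  have h₃ : ((0 : K), (2 : K)) ≠ (0, -2) := by
    simp only [ne_eq, Prod.mk.injEq, true_and]
    grind
  rw [Nat.card_sum, ← Set.coe_ofPred, ← Set.coe_ofPred, Nat.card_coe_set_eq, Nat.card_coe_set_eq,
    h₁, h₂, Set.ncard_prod, ncard_compl_zero, Set.ncard_univ, Set.ncard_compl, Set.ncard_pair h₃,
    Nat.card_prod, sq]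

theorem degreeSet'_cageGraph [Finite K] (hK : SmallNe K) (hcard : 7 ≤ Nat.card K) :
    degreeSet' (cageGraph hK) = {Nat.card K + 1, 2 * Nat.card K - 3} := by
  have hline : ∀ {m b : K} (hl : IsRetained (m, b)),
      ndeg (cageGraph hK) (.inr ⟨(m, b), hl⟩) = Nat.card K + 1 := by
    intro m b hl
    rw [ndeg_line, ncard_compl_zero, ncard_lineAdj hK hl]
    lia
  have hcentre : ∀ {x : K} (hx : x ≠ 0),
      ndeg (cageGraph hK) (.inl ⟨(x, 0), hx⟩) = 2 * Nat.card K - 3 := by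
    intro x hx
    have h2 : ¬((0 : K) = 2 ∨ (0 : K) = -2) := by
      have := hK.1
      grind
    rw [ndeg_point, ncard_starAdj_zero hK, ncard_isRetained_of_ne h2]
    lia
  ext d
  constructor
  · rintro ⟨⟨⟨x, y⟩, hx⟩ | ⟨⟨m, b⟩, hl⟩, rfl⟩
    · by_cases h0 : y = 0
      · subst h0
        exact Or.inr (hcentre hx)
      left
      by_cases hy : y = 2 ∨ y = -2
      · rw [ndeg_point, ncard_starAdj_two hK hy, ncard_isRetained_of_two hy]
        lia
      · rw [ndeg_point, ncard_starAdj_of_ne hK h0 hy, ncard_isRetained_of_ne hy, add_comm]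
    · exact Or.inl (hline hl)
  · rintro (rfl | rfl)
    · exact ⟨_, hline (m := 1) (b := 0) (by simp [IsRetained])⟩
    · exact ⟨_, hcentre (one_ne_zero)⟩

theorem egirth_cageGraph (hK : SmallNe K) : (cageGraph hK).egirth = 5 := by
  have h5 : 5 ≤ (cageGraph hK).egirth := five_le_egirth
    (fun _ _ _ => cageGraph_not_triangle hK) (fun _ _ _ _ => cageGraph_common_unique hK)
  obtain ⟨h2, h3, h4, -⟩ := id hK
  have hl : IsRetained ((-2 : K), (4 : K)) := fun h => h2 (neg_eq_zero.mp h.1)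
  have hl₀ : IsRetained ((0 : K), (0 : K)) := fun h => by
    rcases h.2 with h | h
    · exact h2 h.symm
    · exact h2 (zero_eq_neg.mp h)
  refine egirth_eq_five h5 (a := .inl ⟨(1, 0), one_ne_zero⟩) (b := .inl ⟨(1, 2), one_ne_zero⟩)
    (c := .inr ⟨(-2, 4), hl⟩) (d := .inl ⟨(2, 0), h2⟩) (e := .inr ⟨(0, 0), hl₀⟩)
    ?_ ?_ ?_ ?_ ?_ ?_
  · have : (1 : K) ≠ 2 := by grind
    simp [h2, h2.symm, this]
  · exact ⟨rfl, Or.inl ⟨rfl, h2, by grind, by grind⟩⟩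
  · show (2 : K) = -2 * 1 + 4
    ring
  · show (0 : K) = -2 * 2 + 4
    ring
  · show (0 : K) = 0 * 2 + 0
    ring
  · show (0 : K) = 0 * 1 + 0
    ring

end Field

theorem smallNe_zmod {q : ℕ} [Fact q.Prime] (hq : 7 ≤ q) : SmallNe (ZMod q) := by
  have h : ∀ n : ℕ, 0 < n → n < 7 → (n : ZMod q) ≠ 0 := fun n h₀ h₇ h =>
    (Nat.le_of_dvd h₀ ((ZMod.natCast_eq_zero_iff n q).mp h)).not_gt (by lia)
  exact ⟨by exact_mod_cast h 2 (by lia) (by lia), by exact_mod_cast h 3 (by lia) (by lia),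
    by exact_mod_cast h 4 (by lia) (by lia), by exact_mod_cast h 5 (by lia) (by lia),
    by exact_mod_cast h 6 (by lia) (by lia)⟩

/-- for every prime q ≡ 3 (mod 4) with q ≥ 7 and r = q+1, the minimum order
of a graph with degree set {r, 2r−5} and girth 5 is r(2r−5) + 1 = 2q² − q − 2. -/
theorem stmt15 (q r : ℕ) (hq : q.Prime) (hq3 : q % 4 = 3) (hq7 : 7 ≤ q) (hr : r = q + 1) :
    r * (2 * r - 5) + 1 = 2 * q ^ 2 - q - 2 ∧
    IsLeast (cageOrders {r, 2 * r - 5}) (r * (2 * r - 5) + 1) := by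
  subst hr
  have hm : 2 * (q + 1) - 5 = 2 * q - 3 := by lia
  have horder : (q + 1) * (2 * q - 3) + 1 = 2 * q ^ 2 - q - 2 ∧
      (q - 1) * q + (q ^ 2 - 2) = (q + 1) * (2 * q - 3) + 1 := by
    obtain ⟨k, rfl⟩ := Nat.exists_eq_add_of_le hq7
    have h₁ : 2 * (7 + k) - 3 = 2 * k + 11 := by lia
    have h₂ : 7 + k - 1 = k + 6 := by lia
    rw [h₁, h₂]
    ring_nf
    lia
  rw [hm]
  refine ⟨horder.1, ?_, ?_⟩
  · have := Fact.mk hq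
    have hK := smallNe_zmod hq7
    refine ⟨CageVertex (ZMod q), cageGraph hK, inferInstance, ?_, egirth_cageGraph hK, ?_⟩
    · rw [card_cageVertex hK, Nat.card_zmod, horder.2]
    · rw [degreeSet'_cageGraph hK (by rwa [Nat.card_zmod]), Nat.card_zmod]
  · rintro _ ⟨V, G, hV, rfl, hG, hD⟩
    obtain ⟨v, hv⟩ : 2 * q - 3 ∈ degreeSet' G := hD ▸ Or.inr rfl
    have hmin : ∀ w, q + 1 ≤ ndeg G w := by
      intro w
      have hw : ndeg G w ∈ ({q + 1, 2 * q - 3} : Set ℕ) := hD ▸ ⟨w, rfl⟩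
      rcases hw with hw | hw
      · exact hw.ge
      · rw [hw]
        lia
    rw [← hv]
    exact moore_bound hG.ge hmin v
end
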